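/- arXiv:1905.02539 — 2 statements merged into one kernel-verified Lean document; each statement's English description precedes it below -/
import Mathlib

section
/- Let k ≥ 6 be even, let s, w ∈ ℂ satisfy 2 < Re(s) < k−2 and Re(w) < min{Re(s)−1, k−1−Re(s)}, and let z ∈ ℍ². Then for every γ₀ ∈ Γ, E_{s,k−s}(γ₀·z; w) = j(γ₀,z)^{k·1}·E_{s,k−s}(z;w); that is, the double Eisenstein series transforms like a Hilbert modular form of parallel weight k under Γ. -/
open Complex

noncomputable section

namespace HilbertPaper

/-- Möbius action of a real 2×2 matrix on a complex number. -/
def moebius (g : Matrix (Fin 2) (Fin 2) ℝ) (z : ℂ) : ℂ :=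
  (((g 0 0 : ℝ) : ℂ) * z + ((g 0 1 : ℝ) : ℂ)) / (((g 1 0 : ℝ) : ℂ) * z + ((g 1 1 : ℝ) : ℂ))

/-- Automorphy factor `j(g, z) = c z + d`. -/
def jfac (g : Matrix (Fin 2) (Fin 2) ℝ) (z : ℂ) : ℂ :=
  ((g 1 0 : ℝ) : ℂ) * z + ((g 1 1 : ℝ) : ℂ)

variable (F : Type) [Field F] [NumberField F]

/-- The embedding of the ring of integers into ℝ induced by a real embedding σ of F. -/
def emb (σ : F →+* ℝ) : NumberField.RingOfIntegers F →+* ℝ :=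
  σ.comp (algebraMap (NumberField.RingOfIntegers F) F)

/-- An element of F is totally positive when both real embeddings are positive on it. -/
def TotPos (σ₁ σ₂ : F →+* ℝ) (x : F) : Prop := 0 < σ₁ x ∧ 0 < σ₂ x

/-- `F` is a real quadratic field with narrow class number one, whose two real embeddings
are `σ₁ ≠ σ₂`; narrow class number one is expressed as: every nonzero ideal of the ring of
integers has a totally positive generator. -/
def RealQuadNarrowOne (σ₁ σ₂ : F →+* ℝ) : Prop :=
  Module.finrank ℚ F = 2 ∧ σ₁ ≠ σ₂ ∧
    ∀ I : Ideal (NumberField.RingOfIntegers F), I ≠ ⊥ →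
      ∃ a : NumberField.RingOfIntegers F,
        TotPos F σ₁ σ₂ (algebraMap (NumberField.RingOfIntegers F) F a) ∧ I = Ideal.span {a}

/-- Γ = SL₂(O). -/
abbrev SL2O := Matrix.SpecialLinearGroup (Fin 2) (NumberField.RingOfIntegers F)

/-- The real matrix obtained from γ ∈ SL₂(O) by applying σ entrywise. -/
def mat (σ : F →+* ℝ) (γ : SL2O F) : Matrix (Fin 2) (Fin 2) ℝ :=
  (γ : Matrix (Fin 2) (Fin 2) (NumberField.RingOfIntegers F)).map (emb F σ)

/-- Membership in the subgroup A = {diag(ε, ε⁻¹) : ε a totally positive unit}. -/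
def IsInA (σ₁ σ₂ : F →+* ℝ) (a : SL2O F) : Prop :=
  ∃ ε : (NumberField.RingOfIntegers F)ˣ,
    TotPos F σ₁ σ₂ (algebraMap (NumberField.RingOfIntegers F) F (ε : NumberField.RingOfIntegers F)) ∧
    (a : Matrix (Fin 2) (Fin 2) (NumberField.RingOfIntegers F)) =
      !![(ε : NumberField.RingOfIntegers F), 0; 0, ((ε⁻¹ : (NumberField.RingOfIntegers F)ˣ) : NumberField.RingOfIntegers F)]

/-- The relation on Γ whose quotient is the coset space A\Γ. -/
def ARel (σ₁ σ₂ : F →+* ℝ) (γ γ' : SL2O F) : Prop :=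
  ∃ a : SL2O F, IsInA F σ₁ σ₂ a ∧ γ' = a * γ

/-- The summand of the Cohen kernel: (γ₁z₁)^{-s} (γ₂z₂)^{-s} j(γ,z)^{-k·1}. -/
def cohenSummand (σ₁ σ₂ : F →+* ℝ) (k : ℕ) (s : ℂ) (z₁ z₂ : ℂ) (γ : SL2O F) : ℂ :=
  moebius (mat F σ₁ γ) z₁ ^ (-s) * moebius (mat F σ₂ γ) z₂ ^ (-s) *
    (jfac (mat F σ₁ γ) z₁ ^ (-(k : ℤ)) * jfac (mat F σ₂ γ) z₂ ^ (-(k : ℤ)))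


/-- Membership in Γ∞⁺, the upper-triangular elements of Γ with totally positive diagonal. -/
def IsInGammaInfPos (σ₁ σ₂ : F →+* ℝ) (p : SL2O F) : Prop :=
  (p : Matrix (Fin 2) (Fin 2) (NumberField.RingOfIntegers F)) 1 0 = 0 ∧
  TotPos F σ₁ σ₂ (algebraMap (NumberField.RingOfIntegers F) F
    ((p : Matrix (Fin 2) (Fin 2) (NumberField.RingOfIntegers F)) 0 0)) ∧
  TotPos F σ₁ σ₂ (algebraMap (NumberField.RingOfIntegers F) F
    ((p : Matrix (Fin 2) (Fin 2) (NumberField.RingOfIntegers F)) 1 1))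

/-- The relation on Γ whose quotient is the coset space Γ∞⁺\Γ. -/
def GammaInfRel (σ₁ σ₂ : F →+* ℝ) (γ γ' : SL2O F) : Prop :=
  ∃ p : SL2O F, IsInGammaInfPos F σ₁ σ₂ p ∧ γ' = p * γ

/-- The relation on Γ × Γ whose quotient is (Γ∞⁺\Γ)². -/
def PairRel (σ₁ σ₂ : F →+* ℝ) (p q : SL2O F × SL2O F) : Prop :=
  GammaInfRel F σ₁ σ₂ p.1 q.1 ∧ GammaInfRel F σ₁ σ₂ p.2 q.2

/-- `c_{γδ⁻¹}`, the lower-left entry of γδ⁻¹. -/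
def lowc (γ δ : SL2O F) : NumberField.RingOfIntegers F :=
  ((γ * δ⁻¹ : SL2O F) : Matrix (Fin 2) (Fin 2) (NumberField.RingOfIntegers F)) 1 0

/-- The summand of the double Eisenstein series E_{s, k-s}(z; w). -/
def dblSummand (σ₁ σ₂ : F →+* ℝ) (k : ℕ) (s w : ℂ) (z₁ z₂ : ℂ) (γ δ : SL2O F) : ℂ :=
  ((σ₁ (algebraMap (NumberField.RingOfIntegers F) F (lowc F γ δ)) : ℝ) : ℂ) ^ (w - 1) *
  ((σ₂ (algebraMap (NumberField.RingOfIntegers F) F (lowc F γ δ)) : ℝ) : ℂ) ^ (w - 1) *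
  ((jfac (mat F σ₁ γ) z₁ / jfac (mat F σ₁ δ) z₁) ^ (-s) *
   (jfac (mat F σ₂ γ) z₂ / jfac (mat F σ₂ δ) z₂) ^ (-s)) *
  (jfac (mat F σ₁ δ) z₁ ^ (-(k : ℤ)) * jfac (mat F σ₂ δ) z₂ ^ (-(k : ℤ)))

open Classical in
/-- The summand of the double Eisenstein series, extended by zero to pairs whose
`c_{γδ⁻¹}` is not totally positive. -/
def dblExt (σ₁ σ₂ : F →+* ℝ) (k : ℕ) (s w : ℂ) (z₁ z₂ : ℂ) (γ δ : SL2O F) : ℂ :=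
  if TotPos F σ₁ σ₂ (algebraMap (NumberField.RingOfIntegers F) F (lowc F γ δ)) then
    dblSummand F σ₁ σ₂ k s w z₁ z₂ γ δ
  else 0

set_option linter.unusedSectionVars false

lemma mat_mul (σ : F →+* ℝ) (γ δ : SL2O F) : mat F σ (γ * δ) = mat F σ γ * mat F σ δ := by
  simp only [mat, Matrix.SpecialLinearGroup.coe_mul, Matrix.map_mul]

lemma det_mat (σ : F →+* ℝ) (γ : SL2O F) : (mat F σ γ).det = 1 := by
  have h := (RingHom.map_det (emb F σ) (γ : Matrix (Fin 2) (Fin 2) _)).symm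
  rwa [γ.det_coe, map_one] at h

/-- The automorphy factor does not vanish on the upper half-plane. -/
lemma jfac_ne_zero {g : Matrix (Fin 2) (Fin 2) ℝ} (hg : g.det ≠ 0) {z : ℂ} (hz : 0 < z.im) :
    jfac g z ≠ 0 := by
  intro h
  have him : g 1 0 * z.im = 0 := by simpa [jfac] using congrArg Complex.im h
  have hc : g 1 0 = 0 := (mul_eq_zero.mp him).resolve_right hz.ne'
  have hd : g 1 1 = 0 := by simpa [jfac, hc] using h
  exact hg (by simp [Matrix.det_fin_two, hc, hd])

/-- The cocycle relation for the automorphy factor. -/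
lemma jfac_moebius (g h : Matrix (Fin 2) (Fin 2) ℝ) {z : ℂ} (hz : jfac h z ≠ 0) :
    jfac g (moebius h z) = jfac (g * h) z / jfac h z := by
  rw [eq_div_iff hz]
  simp only [jfac, moebius, Matrix.mul_apply, Fin.sum_univ_two] at hz ⊢
  push_cast
  linear_combination ((g 1 0 : ℝ) : ℂ) * div_mul_cancel₀ ((h 0 0 : ℂ) * z + h 0 1) hz

lemma lowc_mul_right (γ δ γ₀ : SL2O F) : lowc F (γ * γ₀) (δ * γ₀) = lowc F γ δ := by
  simp only [lowc, mul_inv_rev, mul_assoc, mul_inv_cancel_left]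

lemma gammaInfRel_mul_right (σ₁ σ₂ : F →+* ℝ) (γ γ' γ₀ : SL2O F) :
    GammaInfRel F σ₁ σ₂ (γ * γ₀) (γ' * γ₀) ↔ GammaInfRel F σ₁ σ₂ γ γ' := by
  simp only [GammaInfRel, ← mul_assoc, mul_left_inj]

/-- Right translation by `γ₀` on `(Γ∞⁺\Γ)²`. -/
def quotMulRight (σ₁ σ₂ : F →+* ℝ) (γ₀ : SL2O F) :
    Quot (PairRel F σ₁ σ₂) ≃ Quot (PairRel F σ₁ σ₂) :=
  Quot.congr ((Equiv.mulRight γ₀).prodCongr (Equiv.mulRight γ₀)) fun p q => by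
    simp [PairRel, gammaInfRel_mul_right]

lemma dblExt_moebius (σ₁ σ₂ : F →+* ℝ) (k : ℕ) (s w : ℂ) {z₁ z₂ : ℂ}
    (hz₁ : 0 < z₁.im) (hz₂ : 0 < z₂.im) (γ₀ γ δ : SL2O F) :
    dblExt F σ₁ σ₂ k s w (moebius (mat F σ₁ γ₀) z₁) (moebius (mat F σ₂ γ₀) z₂) γ δ =
      (jfac (mat F σ₁ γ₀) z₁ ^ (k : ℤ) * jfac (mat F σ₂ γ₀) z₂ ^ (k : ℤ)) *
        dblExt F σ₁ σ₂ k s w z₁ z₂ (γ * γ₀) (δ * γ₀) := by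
  have h₁ : jfac (mat F σ₁ γ₀) z₁ ≠ 0 := jfac_ne_zero (by simp [det_mat]) hz₁
  have h₂ : jfac (mat F σ₂ γ₀) z₂ ≠ 0 := jfac_ne_zero (by simp [det_mat]) hz₂
  rw [dblExt, dblExt, lowc_mul_right, mul_ite, mul_zero]
  split_ifs
  swap
  · rfl
  simp only [dblSummand, lowc_mul_right, jfac_moebius _ _ h₁, jfac_moebius _ _ h₂, ← mat_mul,
    div_div_div_cancel_right₀ h₁, div_div_div_cancel_right₀ h₂, div_zpow, zpow_neg,
    inv_div]
  ring

/-- For even `k ≥ 6`, `2 < Re s < k - 2` and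
`Re w < min (Re s - 1) (k - 1 - Re s)`, the double Eisenstein series satisfies
`E_{s,k-s}(γ₀·z; w) = j(γ₀,z)^{k·1} E_{s,k-s}(z;w)` for every `γ₀ ∈ Γ`. -/
theorem statement12 (σ₁ σ₂ : F →+* ℝ) (hF : RealQuadNarrowOne F σ₁ σ₂)
    (k : ℕ) (hkeven : Even k) (hk6 : 6 ≤ k)
    (s w : ℂ) (hs1 : 2 < s.re) (hs2 : s.re < (k : ℝ) - 2)
    (hw : w.re < min (s.re - 1) ((k : ℝ) - 1 - s.re))
    (E : ℂ → ℂ → Quot (PairRel F σ₁ σ₂) → ℂ)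
    (hE : ∀ (u₁ u₂ : ℂ) (p : SL2O F × SL2O F),
      E u₁ u₂ (Quot.mk _ p) = dblExt F σ₁ σ₂ k s w u₁ u₂ p.1 p.2)
    (z₁ z₂ : ℂ) (hz₁ : 0 < z₁.im) (hz₂ : 0 < z₂.im)
    (γ₀ : SL2O F) :
    (∑' q, E (moebius (mat F σ₁ γ₀) z₁) (moebius (mat F σ₂ γ₀) z₂) q)
      = (jfac (mat F σ₁ γ₀) z₁ ^ (k : ℤ) * jfac (mat F σ₂ γ₀) z₂ ^ (k : ℤ)) *
          ∑' q, E z₁ z₂ q := by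
  rw [← tsum_mul_left, ← (quotMulRight F σ₁ σ₂ γ₀).tsum_eq fun q => _ * E z₁ z₂ q]
  refine tsum_congr fun q => ?_
  induction q using Quot.ind with
  | mk p =>
    have hq : quotMulRight F σ₁ σ₂ γ₀ (Quot.mk _ p) = Quot.mk _ (p.1 * γ₀, p.2 * γ₀) := rfl
    rw [hq, hE, hE, dblExt_moebius F σ₁ σ₂ k s w hz₁ hz₂]

end HilbertPaper
end
end

section
/- Let k ≥ 6 be even, let s, w ∈ ℂ satisfy 2 < Re(s) < k−2 and Re(w) < min{Re(s)−1, k−1−Re(s)}, and fix Y > 1. Then E_{s,k−s}(z;w) tends to 0 as N(Im z) = y₁y₂ → ∞ subject to Y⁻¹ ≤ y₁/y₂ ≤ Y; that is, for every ε > 0 there exists T > 0 such that for all z = (x₁+iy₁, x₂+iy₂) ∈ ℍ² with Y⁻¹ ≤ y₁/y₂ ≤ Y and y₁y₂ > T, one has |E_{s,k−s}(z;w)| < ε. -/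
open Complex

noncomputable section

namespace HilbertPaper

variable (F : Type) [Field F] [NumberField F]

section Arithmetic

set_option linter.unusedSectionVars false

variable {F}

variable {σ₁ σ₂ : F →+* ℝ}

lemma norm_eq_emb_mul_emb (hF : RealQuadNarrowOne F σ₁ σ₂) (a : NumberField.RingOfIntegers F) :
    ((Algebra.norm ℤ a : ℤ) : ℝ) = emb F σ₁ a * emb F σ₂ a := by
  classical
  obtain ⟨h2, hne, -⟩ := hF
  have h := Algebra.norm_eq_prod_embeddings ℚ ℂ (algebraMap (NumberField.RingOfIntegers F) F a)
  set τ₁ : F →ₐ[ℚ] ℂ := (Complex.ofRealHom.comp σ₁).toRatAlgHom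
  set τ₂ : F →ₐ[ℚ] ℂ := (Complex.ofRealHom.comp σ₂).toRatAlgHom
  have hτ : τ₁ ≠ τ₂ := by
    intro h
    apply hne
    ext x
    have := DFunLike.congr_fun h x
    exact Complex.ofReal_injective this
  have huniv : (Finset.univ : Finset (F →ₐ[ℚ] ℂ)) = {τ₁, τ₂} := by
    symm
    rw [← Finset.card_eq_iff_eq_univ, Finset.card_pair hτ, AlgHom.card, h2]
  rw [huniv, Finset.prod_pair hτ, ← Algebra.coe_norm_int] at h
  have h' : (((Algebra.norm ℤ a : ℤ) : ℝ) : ℂ) = ((emb F σ₁ a * emb F σ₂ a : ℝ) : ℂ) := by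
    rw [Complex.ofReal_mul]
    refine Eq.trans ?_ h
    simp
  exact_mod_cast h'

lemma one_le_abs_emb_mul_emb (hF : RealQuadNarrowOne F σ₁ σ₂) {a : NumberField.RingOfIntegers F}
    (ha : a ≠ 0) : 1 ≤ |emb F σ₁ a * emb F σ₂ a| := by
  rw [← norm_eq_emb_mul_emb hF, ← Int.cast_abs]
  exact_mod_cast Int.one_le_abs (Algebra.norm_ne_zero_iff.2 ha)

lemma emb_mul_emb_unit (hF : RealQuadNarrowOne F σ₁ σ₂) (u : (NumberField.RingOfIntegers F)ˣ)
    (h1 : 0 < emb F σ₁ u) (h2 : 0 < emb F σ₂ u) : emb F σ₁ u * emb F σ₂ u = 1 := by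
  have h := norm_eq_emb_mul_emb hF (u : NumberField.RingOfIntegers F)
  rcases Int.isUnit_iff.1 (u.isUnit.map (Algebra.norm ℤ)) with h' | h'
  · rw [← h, h']; simp
  · rw [h'] at h
    have := mul_pos h1 h2
    rw [← h] at this
    norm_num at this

lemma emb_injective (σ : F →+* ℝ) : Function.Injective (emb F σ) :=
  σ.injective.comp NumberField.RingOfIntegers.coe_injective

lemma exists_emb_ne (hne : σ₁ ≠ σ₂) :
    ∃ θ : NumberField.RingOfIntegers F, emb F σ₁ θ ≠ emb F σ₂ θ := by
  by_contra! h
  exact hne (IsLocalization.ringHom_ext (nonZeroDivisors (NumberField.RingOfIntegers F))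
    (RingHom.ext h))

lemma exists_totPos_unit_one_lt (hF : RealQuadNarrowOne F σ₁ σ₂) :
    ∃ u : (NumberField.RingOfIntegers F)ˣ,
      1 < emb F σ₁ u ∧ 0 < emb F σ₂ u ∧ emb F σ₁ u * emb F σ₂ u = 1 := by
  obtain ⟨u, hu⟩ := NumberField.Units.dirichletUnitTheorem.exists_unit F
    (NumberField.InfinitePlace.mk (Complex.ofRealHom.comp σ₂))
  have hpl : NumberField.InfinitePlace.mk (Complex.ofRealHom.comp σ₁) ≠
      NumberField.InfinitePlace.mk (Complex.ofRealHom.comp σ₂) := by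
    rw [Ne, NumberField.InfinitePlace.mk_eq_iff]
    rintro (h | h)
    · exact hF.2.1 (RingHom.ext fun x => Complex.ofReal_injective (DFunLike.congr_fun h x))
    · refine hF.2.1 (RingHom.ext fun x => Complex.ofReal_injective ?_)
      have := DFunLike.congr_fun h x
      simpa [NumberField.ComplexEmbedding.conjugate_coe_eq] using this
  have h := hu _ hpl
  rw [NumberField.InfinitePlace.apply] at h
  have hn : ‖(Complex.ofRealHom.comp σ₁) ((u : NumberField.RingOfIntegers F) : F)‖
      = |emb F σ₁ u| := by
    simp [emb]
  rw [hn] at h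
  have hu0 : ∀ σ : F →+* ℝ, emb F σ u ≠ 0 := fun σ =>
    (map_ne_zero_iff _ (emb_injective σ)).2 u.ne_zero
  have habs : |emb F σ₁ u| < 1 := by
    by_contra! h1
    exact absurd (Real.log_nonneg h1) (not_le.2 h)
  have hinv : ∀ σ : F →+* ℝ, emb F σ ((u⁻¹ ^ 2 : (NumberField.RingOfIntegers F)ˣ)) =
      ((emb F σ u) ^ 2)⁻¹ := fun σ => by
    rw [Units.val_pow_eq_pow_val, map_pow, ← inv_pow]
    congr 1
    apply eq_inv_of_mul_eq_one_left
    rw [← map_mul, Units.inv_mul, map_one]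
  have hp : ∀ σ : F →+* ℝ, 0 < emb F σ ((u⁻¹ ^ 2 : (NumberField.RingOfIntegers F)ˣ)) := fun σ => by
    rw [hinv]
    have := hu0 σ
    positivity
  refine ⟨u⁻¹ ^ 2, ?_, hp σ₂, emb_mul_emb_unit hF _ (hp σ₁) (hp σ₂)⟩
  rw [hinv]
  have := hu0 σ₁
  refine (one_lt_inv₀ (by positivity)).2 ?_
  rw [← sq_abs]
  exact pow_lt_one₀ (abs_nonneg _) habs two_ne_zero

/-- The image of the integers under the two real embeddings is cobounded in `ℝ²`. -/
lemma exists_abs_sub_emb_le (hne : σ₁ ≠ σ₂) : ∃ X : ℝ, 0 ≤ X ∧ ∀ x₁ x₂ : ℝ,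
    ∃ α : NumberField.RingOfIntegers F, |x₁ - emb F σ₁ α| ≤ X ∧ |x₂ - emb F σ₂ α| ≤ X := by
  obtain ⟨θ, hθ⟩ := exists_emb_ne hne
  set t₁ := emb F σ₁ θ
  set t₂ := emb F σ₂ θ
  have hd : t₁ - t₂ ≠ 0 := sub_ne_zero.2 hθ
  refine ⟨1 + |t₁| + |t₂|, by positivity, fun x₁ x₂ => ?_⟩
  set b := (x₁ - x₂) / (t₁ - t₂) with hb
  set a := x₁ - b * t₁ with ha
  have h1 : x₁ = a + b * t₁ := by rw [ha]; ring
  have h2 : x₂ = a + b * t₂ := by rw [ha, hb]; field_simp; ring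
  have key : ∀ t : ℝ, |(a + b * t) - (⌊a⌋ + ⌊b⌋ * t)| ≤ 1 + |t| := fun t => by
    have : (a + b * t) - (⌊a⌋ + ⌊b⌋ * t) = Int.fract a + Int.fract b * t := by
      rw [← Int.self_sub_floor, ← Int.self_sub_floor]; ring
    rw [this]
    refine (abs_add_le _ _).trans (add_le_add ?_ ?_)
    · rw [abs_of_nonneg (Int.fract_nonneg _)]; exact (Int.fract_lt_one _).le
    · rw [abs_mul, abs_of_nonneg (Int.fract_nonneg _)]
      exact mul_le_of_le_one_left (abs_nonneg _) (Int.fract_lt_one _).le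
  refine ⟨⌊a⌋ + ⌊b⌋ * θ, ?_, ?_⟩
  · rw [h1, map_add, map_mul, map_intCast, map_intCast]
    exact (key t₁).trans (by linarith [abs_nonneg t₂])
  · rw [h2, map_add, map_mul, map_intCast, map_intCast]
    exact (key t₂).trans (by linarith [abs_nonneg t₁])

/-- The larger of the absolute values of the two real conjugates of an integer. -/
def house (σ₁ σ₂ : F →+* ℝ) (a : NumberField.RingOfIntegers F) : ℝ :=
  max |emb F σ₁ a| |emb F σ₂ a|

lemma house_nonneg (a : NumberField.RingOfIntegers F) : 0 ≤ house σ₁ σ₂ a :=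
  le_max_of_le_left (abs_nonneg _)

lemma one_le_house (hF : RealQuadNarrowOne F σ₁ σ₂) {a : NumberField.RingOfIntegers F}
    (ha : a ≠ 0) : 1 ≤ house σ₁ σ₂ a := by
  by_contra! h
  have h1 := one_le_abs_emb_mul_emb hF ha
  rw [abs_mul] at h1
  have := mul_lt_one_of_nonneg_of_lt_one_left (abs_nonneg _) ((le_max_left _ _).trans_lt h)
    ((le_max_right |emb F σ₁ a| |emb F σ₂ a|).trans h.le)
  linarith

variable (σ₁ σ₂) in
/-- The two real embeddings as a `ℤ`-linear map from the integers to the plane. -/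
def embPair : NumberField.RingOfIntegers F →ₗ[ℤ] ℝ × ℝ :=
  ((emb F σ₁).prod (emb F σ₂)).toAddMonoidHom.toIntLinearMap

lemma norm_embPair (a : NumberField.RingOfIntegers F) : ‖embPair σ₁ σ₂ a‖ = house σ₁ σ₂ a := rfl

lemma embPair_injective : Function.Injective (embPair σ₁ σ₂) := fun _ _ h =>
  emb_injective σ₁ (congrArg Prod.fst h)

lemma summable_one_add_house_rpow (hF : RealQuadNarrowOne F σ₁ σ₂) {r : ℝ} (hr : 2 < r) :
    Summable fun a : NumberField.RingOfIntegers F => (1 + house σ₁ σ₂ a) ^ (-r) := by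
  have hdisc : DiscreteTopology (LinearMap.range (embPair σ₁ σ₂)) := by
    refine DiscreteTopology.of_forall_le_dist one_pos ?_
    rintro ⟨_, a, rfl⟩ ⟨_, b, rfl⟩ hab
    rw [Subtype.dist_eq, dist_eq_norm, ← map_sub, norm_embPair]
    refine one_le_house hF (sub_ne_zero.2 ?_)
    rintro rfl
    exact hab rfl
  have hrank : Module.finrank ℤ (LinearMap.range (embPair σ₁ σ₂)) = 2 := by
    rw [LinearMap.finrank_range_of_inj embPair_injective, NumberField.RingOfIntegers.rank, hF.1]
  have hs := ZLattice.summable_norm_rpow (LinearMap.range (embPair σ₁ σ₂)) (-r)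
    (by rw [hrank]; push_cast; linarith)
  have hs' : Summable fun a : NumberField.RingOfIntegers F => house σ₁ σ₂ a ^ (-r) := by
    have h := ((LinearEquiv.ofInjective (embPair σ₁ σ₂) embPair_injective).toEquiv.summable_iff
      (f := fun z => ‖z‖ ^ (-r))).2 hs
    refine h.congr fun a => ?_
    rw [← norm_embPair]
    rfl
  refine Summable.of_norm_bounded_eventually hs' ?_
  filter_upwards [(Set.finite_singleton (0 : NumberField.RingOfIntegers F)).compl_mem_cofinite]
    with a ha
  have h1 := one_le_house hF ha
  rw [Real.norm_of_nonneg (Real.rpow_nonneg (by linarith) _)]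
  exact Real.rpow_le_rpow_of_nonpos (by linarith) (by linarith) (by linarith)

end Arithmetic

section Estimates

set_option linter.unusedSectionVars false

variable {F}
variable {σ₁ σ₂ : F →+* ℝ}

lemma abs_le_norm_mul_add_div {m X a : ℝ} {z : ℂ} (hm : 0 < m) (hz : m ≤ z.im)
    (ha : |z.re - a| ≤ X) (c d : ℝ) :
    |c| ≤ (1 / m) * ‖(c : ℂ) * z + d‖ ∧ |d + c * a| ≤ (1 + X / m) * ‖(c : ℂ) * z + d‖ := by
  have him : ((c : ℂ) * z + d).im = c * z.im := by simp
  have hre : ((c : ℂ) * z + d).re = c * z.re + d := by simp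
  have h1 := Complex.abs_im_le_norm ((c : ℂ) * z + d)
  have h2 := Complex.abs_re_le_norm ((c : ℂ) * z + d)
  rw [him, abs_mul, abs_of_pos (hm.trans_le hz)] at h1
  rw [hre] at h2
  have hc : |c| ≤ (1 / m) * ‖(c : ℂ) * z + d‖ := by
    rw [one_div, ← div_eq_inv_mul, le_div_iff₀ hm]
    exact (mul_le_mul_of_nonneg_left hz (abs_nonneg c)).trans h1
  refine ⟨hc, ?_⟩
  have h3 : d + c * a = (c * z.re + d) - c * (z.re - a) := by ring
  rw [h3]
  refine (abs_sub _ _).trans ?_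
  rw [abs_mul]
  calc |c * z.re + d| + |c| * |z.re - a|
      ≤ ‖(c : ℂ) * z + d‖ + ((1 / m) * ‖(c : ℂ) * z + d‖) * X := by gcongr
    _ = _ := by ring

lemma exists_one_add_house_mul_le (hF : RealQuadNarrowOne F σ₁ σ₂) {m X L : ℝ} (hm : 0 < m)
    (hX : 0 ≤ X) (hL : 0 < L) : ∃ K : ℝ, 0 < K ∧
    ∀ (c d α : NumberField.RingOfIntegers F) (z₁ z₂ : ℂ), (c ≠ 0 ∨ d ≠ 0) →
      m ≤ z₁.im → m ≤ z₂.im → |z₁.re - emb F σ₁ α| ≤ X → |z₂.re - emb F σ₂ α| ≤ X →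
      ‖(emb F σ₁ c : ℂ) * z₁ + emb F σ₁ d‖ ≤ L * ‖(emb F σ₂ c : ℂ) * z₂ + emb F σ₂ d‖ →
      ‖(emb F σ₂ c : ℂ) * z₂ + emb F σ₂ d‖ ≤ L * ‖(emb F σ₁ c : ℂ) * z₁ + emb F σ₁ d‖ →
      (1 + house σ₁ σ₂ c) * (1 + house σ₁ σ₂ (d + c * α)) ≤
        K * (‖(emb F σ₁ c : ℂ) * z₁ + emb F σ₁ d‖ * ‖(emb F σ₂ c : ℂ) * z₂ + emb F σ₂ d‖) := by
  set A : ℝ := 1 + 1 / m + X / m with hA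
  have hXm : 0 ≤ X / m := by positivity
  have hm' : 0 < 1 / m := by positivity
  have hA0 : 0 < A := by positivity
  refine ⟨4 * A ^ 2 * L, by positivity, fun c d α z₁ z₂ hcd hz₁ hz₂ hα₁ hα₂ h12 h21 => ?_⟩
  obtain ⟨hc₁, hd₁⟩ := abs_le_norm_mul_add_div hm hz₁ hα₁ (emb F σ₁ c) (emb F σ₁ d)
  obtain ⟨hc₂, hd₂⟩ := abs_le_norm_mul_add_div hm hz₂ hα₂ (emb F σ₂ c) (emb F σ₂ d)
  set j₁ := ‖(emb F σ₁ c : ℂ) * z₁ + emb F σ₁ d‖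
  set j₂ := ‖(emb F σ₂ c : ℂ) * z₂ + emb F σ₂ d‖
  have hj₁ : 0 ≤ j₁ := norm_nonneg _
  have hj₂ : 0 ≤ j₂ := norm_nonneg _
  set J := max j₁ j₂ with hJ
  have hJ₁ : j₁ ≤ J := le_max_left _ _
  have hJ₂ : j₂ ≤ J := le_max_right _ _
  have hJ0 : 0 ≤ J := hj₁.trans hJ₁
  have hsq : J ^ 2 ≤ L * (j₁ * j₂) := by
    rcases max_choice j₁ j₂ with h | h <;> rw [hJ, h] <;> nlinarith
  have hcJ : house σ₁ σ₂ c ≤ A * J := by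
    refine max_le (hc₁.trans ?_) (hc₂.trans ?_) <;>
      exact mul_le_mul (by linarith) ‹_› ‹_› hA0.le
  have hdJ : house σ₁ σ₂ (d + c * α) ≤ A * J := by
    refine max_le ?_ ?_ <;> rw [map_add, map_mul]
    · exact hd₁.trans (mul_le_mul (by linarith) hJ₁ hj₁ hA0.le)
    · exact hd₂.trans (mul_le_mul (by linarith) hJ₂ hj₂ hA0.le)
  have h1 : 1 ≤ A * J := by
    by_cases hc : c = 0
    · refine (one_le_house hF (a := d + c * α) ?_).trans hdJ
      rw [hc, zero_mul, add_zero]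
      exact hcd.resolve_left (not_not.2 hc)
    · exact (one_le_house hF hc).trans hcJ
  calc (1 + house σ₁ σ₂ c) * (1 + house σ₁ σ₂ (d + c * α))
      ≤ (2 * (A * J)) * (2 * (A * J)) := by
        refine mul_le_mul (by linarith) (by linarith) ?_ (by linarith)
        linarith [house_nonneg (σ₁ := σ₁) (σ₂ := σ₂) (d + c * α)]
    _ = 4 * A ^ 2 * J ^ 2 := by ring
    _ ≤ 4 * A ^ 2 * (L * (j₁ * j₂)) := by gcongr
    _ = _ := by ring

lemma jfac_mat (σ : F →+* ℝ) (γ : SL2O F) (z : ℂ) :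
    jfac (mat F σ γ) z = (emb F σ (γ 1 0) : ℂ) * z + emb F σ (γ 1 1) := rfl

lemma bottom_row_ne_zero (γ : SL2O F) : γ 1 0 ≠ 0 ∨ γ 1 1 ≠ 0 := by
  by_contra! h
  have := γ.det_coe
  rw [Matrix.det_fin_two, h.1, h.2] at this
  simp at this

lemma jfac_mat_ne_zero (σ : F →+* ℝ) (γ : SL2O F) {z : ℂ} (hz : 0 < z.im) :
    jfac (mat F σ γ) z ≠ 0 := by
  rw [jfac_mat]
  intro h
  have him := congrArg Complex.im h
  have hre := congrArg Complex.re h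
  have hc : emb F σ (γ 1 0) = 0 := by
    simpa [hz.ne'] using him
  have hd : emb F σ (γ 1 1) = 0 := by
    simpa [hc] using hre
  rcases bottom_row_ne_zero γ with h | h
  · exact h ((map_eq_zero_iff _ (emb_injective σ)).1 hc)
  · exact h ((map_eq_zero_iff _ (emb_injective σ)).1 hd)

lemma lowc_eq (γ δ : SL2O F) : lowc F γ δ = γ 1 0 * δ 1 1 - γ 1 1 * δ 1 0 := by
  simp [lowc, Matrix.SpecialLinearGroup.coe_inv, Matrix.adjugate_fin_two, Matrix.mul_apply,
    Fin.sum_univ_two, sub_eq_add_neg]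

lemma emb_lowc_mul_im_le (σ : F →+* ℝ) (γ δ : SL2O F) (z : ℂ) :
    emb F σ (lowc F γ δ) * z.im ≤ ‖jfac (mat F σ γ) z‖ * ‖jfac (mat F σ δ) z‖ := by
  rw [← Complex.norm_conj (jfac (mat F σ δ) z), ← norm_mul]
  refine le_trans (le_of_eq ?_) ((le_abs_self _).trans (Complex.abs_im_le_norm _))
  rw [lowc_eq, jfac_mat, jfac_mat]
  simp
  ring

lemma bottom_row_mul {p : SL2O F} (hp : p 1 0 = 0) (γ : SL2O F) (i : Fin 2) :
    (p * γ) 1 i = p 1 1 * γ 1 i := by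
  simp [Matrix.mul_apply, Fin.sum_univ_two, hp]

lemma jfac_mat_mul (σ : F →+* ℝ) {p : SL2O F} (hp : p 1 0 = 0) (γ : SL2O F) (z : ℂ) :
    jfac (mat F σ (p * γ)) z = (emb F σ (p 1 1) : ℂ) * jfac (mat F σ γ) z := by
  rw [jfac_mat, jfac_mat, bottom_row_mul hp, bottom_row_mul hp, map_mul, map_mul]
  push_cast
  ring

lemma emb_mul_emb_of_isInGammaInfPos (hF : RealQuadNarrowOne F σ₁ σ₂) {p : SL2O F}
    (hp : IsInGammaInfPos F σ₁ σ₂ p) : emb F σ₁ (p 1 1) * emb F σ₂ (p 1 1) = 1 := by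
  have hdet := p.det_coe
  rw [Matrix.det_fin_two, hp.1, mul_zero, sub_zero] at hdet
  exact emb_mul_emb_unit hF ⟨p 1 1, p 0 0, by rw [mul_comm, hdet], hdet⟩ hp.2.2.1 hp.2.2.2

/-- Every coset of `Γ∞⁺` has a representative whose two automorphy factors are comparable. -/
lemma exists_balanced (hF : RealQuadNarrowOne F σ₁ σ₂) : ∃ L : ℝ, 0 < L ∧
    ∀ z₁ z₂ : ℂ, 0 < z₁.im → 0 < z₂.im → ∀ γ : SL2O F, ∃ γ' : SL2O F,
      GammaInfRel F σ₁ σ₂ γ γ' ∧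
      ‖jfac (mat F σ₁ γ') z₁‖ ≤ L * ‖jfac (mat F σ₂ γ') z₂‖ ∧
      ‖jfac (mat F σ₂ γ') z₂‖ ≤ L * ‖jfac (mat F σ₁ γ') z₁‖ := by
  obtain ⟨u, hu1, hu2, hu⟩ := exists_totPos_unit_one_lt hF
  set e := emb F σ₁ u
  have he : 0 < e := zero_lt_one.trans hu1
  have he2 : 1 < e ^ 2 := one_lt_pow₀ hu1 two_ne_zero
  refine ⟨e ^ 2, by positivity, fun z₁ z₂ hz₁ hz₂ γ => ?_⟩
  have hJ₁ : 0 < ‖jfac (mat F σ₁ γ) z₁‖ := norm_pos_iff.2 (jfac_mat_ne_zero _ _ hz₁)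
  have hJ₂ : 0 < ‖jfac (mat F σ₂ γ) z₂‖ := norm_pos_iff.2 (jfac_mat_ne_zero _ _ hz₂)
  set J₁ := ‖jfac (mat F σ₁ γ) z₁‖
  set J₂ := ‖jfac (mat F σ₂ γ) z₂‖
  obtain ⟨n, hn1, hn2⟩ := exists_mem_Ico_zpow (div_pos hJ₁ hJ₂) he2
  rw [le_div_iff₀ hJ₂] at hn1
  rw [div_lt_iff₀ hJ₂] at hn2
  have hval : ∀ (σ : F →+* ℝ) (m : ℤ), emb F σ ((u ^ m : (NumberField.RingOfIntegers F)ˣ)) =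
      (emb F σ u) ^ m := fun σ m => by
    have := map_zpow (Units.map (emb F σ : NumberField.RingOfIntegers F →* ℝ)) u m
    have := congrArg Units.val this
    rw [Units.val_zpow_eq_zpow_val] at this
    exact this
  let p : SL2O F := ⟨!![((u ^ n : (NumberField.RingOfIntegers F)ˣ) : NumberField.RingOfIntegers F),
    0; 0, ((u ^ (-n) : (NumberField.RingOfIntegers F)ˣ) : NumberField.RingOfIntegers F)], by
      rw [Matrix.det_fin_two_of, ← Units.val_mul, ← zpow_add, add_neg_cancel]
      simp⟩
  have hp0 : p 1 0 = 0 := rfl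
  have hp1 : p 1 1 = ((u ^ (-n) : (NumberField.RingOfIntegers F)ˣ) :
    NumberField.RingOfIntegers F) := rfl
  have hpos : ∀ m : ℤ, TotPos F σ₁ σ₂ (algebraMap (NumberField.RingOfIntegers F) F
      ((u ^ m : (NumberField.RingOfIntegers F)ˣ) : NumberField.RingOfIntegers F)) := fun m =>
    ⟨by
      change 0 < emb F σ₁ _
      rw [hval]; positivity, by
      change 0 < emb F σ₂ _
      rw [hval]; positivity⟩
  refine ⟨p * γ, ⟨p, ⟨hp0, hpos n, hpos (-n)⟩, rfl⟩, ?_⟩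
  have h2 : emb F σ₂ u = e⁻¹ := eq_inv_of_mul_eq_one_right hu
  have hj1 : ‖jfac (mat F σ₁ (p * γ)) z₁‖ = (e ^ n)⁻¹ * J₁ := by
    rw [jfac_mat_mul _ hp0, norm_mul, hp1, hval, zpow_neg, Complex.norm_real,
      Real.norm_of_nonneg (by positivity)]
  have hj2 : ‖jfac (mat F σ₂ (p * γ)) z₂‖ = e ^ n * J₂ := by
    rw [jfac_mat_mul _ hp0, norm_mul, hp1, hval, h2, zpow_neg, inv_zpow, inv_inv,
      Complex.norm_real, Real.norm_of_nonneg (by positivity)]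
  rw [hj1, hj2]
  have hen : 0 < e ^ n := by positivity
  have hpow : (e ^ 2) ^ n = e ^ n * e ^ n := by
    rw [← zpow_natCast, ← zpow_mul, ← zpow_add₀ he.ne']
    congr 1
    push_cast
    ring
  rw [zpow_add_one₀ (by positivity), hpow] at hn2
  rw [hpow] at hn1
  have hle : e ^ n * J₂ ≤ (e ^ n)⁻¹ * J₁ := by
    rw [← div_eq_inv_mul, le_div_iff₀ hen]
    linarith
  refine ⟨?_, hle.trans (le_mul_of_one_le_left (by positivity) he2.le)⟩
  rw [← div_eq_inv_mul, div_le_iff₀ hen]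
  linarith

lemma ofReal_mul_cpow {a : ℝ} (ha : 0 < a) (x s : ℂ) :
    ((a : ℂ) * x) ^ s = (a : ℂ) ^ s * x ^ s := by
  by_cases hx : x = 0
  · by_cases hs : s = 0
    · simp [hs]
    · simp [hx, hs]
  · have ha' : (a : ℂ) ≠ 0 := by exact_mod_cast ha.ne'
    rw [Complex.cpow_def_of_ne_zero (mul_ne_zero ha' hx), Complex.cpow_def_of_ne_zero ha',
      Complex.cpow_def_of_ne_zero hx, Complex.log_ofReal_mul ha hx, ← Complex.ofReal_log ha.le,
      add_mul, Complex.exp_add]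

lemma ofReal_cpow_mul_cpow_eq_one {a b : ℝ} (ha : 0 < a) (hab : a * b = 1) (s : ℂ) :
    (a : ℂ) ^ s * (b : ℂ) ^ s = 1 := by
  rw [← ofReal_mul_cpow ha, ← Complex.ofReal_mul, hab, Complex.ofReal_one, Complex.one_cpow]

lemma dblExt_mul_left (hF : RealQuadNarrowOne F σ₁ σ₂) (k : ℕ) (s w z₁ z₂ : ℂ) {p : SL2O F}
    (hp : IsInGammaInfPos F σ₁ σ₂ p) (γ δ : SL2O F) :
    dblExt F σ₁ σ₂ k s w z₁ z₂ (p * γ) δ = dblExt F σ₁ σ₂ k s w z₁ z₂ γ δ := by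
  have hu := emb_mul_emb_of_isInGammaInfPos hF hp
  have h1 : 0 < emb F σ₁ (p 1 1) := hp.2.2.1
  have h2 : 0 < emb F σ₂ (p 1 1) := hp.2.2.2
  have hl : lowc F (p * γ) δ = p 1 1 * lowc F γ δ := by
    rw [lowc_eq, lowc_eq, bottom_row_mul hp.1, bottom_row_mul hp.1]; ring
  have hσ : ∀ σ : F →+* ℝ, σ (algebraMap (NumberField.RingOfIntegers F) F (lowc F (p * γ) δ)) =
      emb F σ (p 1 1) * σ (algebraMap (NumberField.RingOfIntegers F) F (lowc F γ δ)) := fun σ => by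
    rw [hl, map_mul, map_mul]; rfl
  have hT : TotPos F σ₁ σ₂ (algebraMap (NumberField.RingOfIntegers F) F (lowc F (p * γ) δ)) ↔
      TotPos F σ₁ σ₂ (algebraMap (NumberField.RingOfIntegers F) F (lowc F γ δ)) := by
    unfold TotPos
    rw [hσ, hσ, mul_pos_iff_of_pos_left h1, mul_pos_iff_of_pos_left h2]
  unfold dblExt
  by_cases h : TotPos F σ₁ σ₂ (algebraMap (NumberField.RingOfIntegers F) F (lowc F γ δ))
  swap
  · rw [if_neg h, if_neg (hT.not.2 h)]
  rw [if_pos h, if_pos (hT.2 h)]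
  unfold dblSummand
  rw [hσ, hσ, jfac_mat_mul _ hp.1, jfac_mat_mul _ hp.1, Complex.ofReal_mul, Complex.ofReal_mul,
    ofReal_mul_cpow h1, ofReal_mul_cpow h2, mul_div_assoc, mul_div_assoc, ofReal_mul_cpow h1,
    ofReal_mul_cpow h2]
  have hw := ofReal_cpow_mul_cpow_eq_one h1 hu (w - 1)
  have hs := ofReal_cpow_mul_cpow_eq_one h1 hu (-s)
  generalize ((emb F σ₁ (p 1 1) : ℝ) : ℂ) ^ (w - 1) = b₁ at *
  generalize ((emb F σ₂ (p 1 1) : ℝ) : ℂ) ^ (w - 1) = b₂ at *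
  generalize ((emb F σ₁ (p 1 1) : ℝ) : ℂ) ^ (-s) = c₁ at *
  generalize ((emb F σ₂ (p 1 1) : ℝ) : ℂ) ^ (-s) = c₂ at *
  rw [show ∀ A B C D G : ℂ, b₁ * A * (b₂ * B) * (c₁ * C * (c₂ * D)) * G =
    (b₁ * b₂) * (c₁ * c₂) * (A * B * (C * D) * G) from fun _ _ _ _ _ => by ring,
    hw, hs, one_mul, one_mul]

lemma dblExt_mul_right (hF : RealQuadNarrowOne F σ₁ σ₂) (k : ℕ) (s w z₁ z₂ : ℂ) {p : SL2O F}
    (hp : IsInGammaInfPos F σ₁ σ₂ p) (γ δ : SL2O F) :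
    dblExt F σ₁ σ₂ k s w z₁ z₂ γ (p * δ) = dblExt F σ₁ σ₂ k s w z₁ z₂ γ δ := by
  have hu := emb_mul_emb_of_isInGammaInfPos hF hp
  have h1 : 0 < emb F σ₁ (p 1 1) := hp.2.2.1
  have h2 : 0 < emb F σ₂ (p 1 1) := hp.2.2.2
  have hu' : (emb F σ₁ (p 1 1))⁻¹ * (emb F σ₂ (p 1 1))⁻¹ = 1 := by
    rw [← mul_inv, hu, inv_one]
  have hl : lowc F γ (p * δ) = p 1 1 * lowc F γ δ := by
    rw [lowc_eq, lowc_eq, bottom_row_mul hp.1, bottom_row_mul hp.1]; ring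
  have hσ : ∀ σ : F →+* ℝ, σ (algebraMap (NumberField.RingOfIntegers F) F (lowc F γ (p * δ))) =
      emb F σ (p 1 1) * σ (algebraMap (NumberField.RingOfIntegers F) F (lowc F γ δ)) := fun σ => by
    rw [hl, map_mul, map_mul]; rfl
  have hT : TotPos F σ₁ σ₂ (algebraMap (NumberField.RingOfIntegers F) F (lowc F γ (p * δ))) ↔
      TotPos F σ₁ σ₂ (algebraMap (NumberField.RingOfIntegers F) F (lowc F γ δ)) := by
    unfold TotPos
    rw [hσ, hσ, mul_pos_iff_of_pos_left h1, mul_pos_iff_of_pos_left h2]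
  have hq : ∀ (a : ℝ) (x y : ℂ), x / ((a : ℂ) * y) = ((a⁻¹ : ℝ) : ℂ) * (x / y) := fun a x y => by
    rw [Complex.ofReal_inv, div_mul_eq_div_div, div_right_comm, div_eq_inv_mul]
  have hk : ((emb F σ₁ (p 1 1) : ℝ) : ℂ) ^ (-(k : ℤ)) * ((emb F σ₂ (p 1 1) : ℝ) : ℂ) ^ (-(k : ℤ))
      = 1 := by
    rw [← mul_zpow, ← Complex.ofReal_mul, hu, Complex.ofReal_one, one_zpow]
  unfold dblExt
  by_cases h : TotPos F σ₁ σ₂ (algebraMap (NumberField.RingOfIntegers F) F (lowc F γ δ))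
  swap
  · rw [if_neg h, if_neg (hT.not.2 h)]
  rw [if_pos h, if_pos (hT.2 h)]
  unfold dblSummand
  rw [hσ, hσ, jfac_mat_mul _ hp.1, jfac_mat_mul _ hp.1, Complex.ofReal_mul, Complex.ofReal_mul,
    ofReal_mul_cpow h1, ofReal_mul_cpow h2, hq, hq, ofReal_mul_cpow (inv_pos.2 h1),
    ofReal_mul_cpow (inv_pos.2 h2), mul_zpow, mul_zpow]
  have hw := ofReal_cpow_mul_cpow_eq_one h1 hu (w - 1)
  have hs := ofReal_cpow_mul_cpow_eq_one (inv_pos.2 h1) hu' (-s)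
  generalize ((emb F σ₁ (p 1 1) : ℝ) : ℂ) ^ (-(k : ℤ)) = a₁ at *
  generalize ((emb F σ₂ (p 1 1) : ℝ) : ℂ) ^ (-(k : ℤ)) = a₂ at *
  generalize ((emb F σ₁ (p 1 1) : ℝ) : ℂ) ^ (w - 1) = b₁ at *
  generalize ((emb F σ₂ (p 1 1) : ℝ) : ℂ) ^ (w - 1) = b₂ at *
  generalize (((emb F σ₁ (p 1 1))⁻¹ : ℝ) : ℂ) ^ (-s) = c₁ at *
  generalize (((emb F σ₂ (p 1 1))⁻¹ : ℝ) : ℂ) ^ (-s) = c₂ at *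
  rw [show ∀ A B C D G H : ℂ, b₁ * A * (b₂ * B) * (c₁ * C * (c₂ * D)) * (a₁ * G * (a₂ * H)) =
    (b₁ * b₂) * (c₁ * c₂) * (a₁ * a₂) * (A * B * (C * D) * (G * H)) from fun _ _ _ _ _ _ => by ring,
    hw, hs, hk, one_mul, one_mul, one_mul]

lemma dblExt_congr (hF : RealQuadNarrowOne F σ₁ σ₂) (k : ℕ) (s w z₁ z₂ : ℂ)
    {p q : SL2O F × SL2O F} (h : PairRel F σ₁ σ₂ p q) :
    dblExt F σ₁ σ₂ k s w z₁ z₂ p.1 p.2 = dblExt F σ₁ σ₂ k s w z₁ z₂ q.1 q.2 := by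
  obtain ⟨⟨a, ha, h1⟩, ⟨b, hb, h2⟩⟩ := h
  rw [h1, h2, dblExt_mul_left hF _ _ _ _ _ ha, dblExt_mul_right hF _ _ _ _ _ hb]

lemma norm_cpow_neg_le (x s : ℂ) :
    ‖x ^ (-s)‖ ≤ ‖x‖ ^ (-s.re) * Real.exp (Real.pi * |s.im|) := by
  refine (Complex.norm_cpow_le x (-s)).trans ?_
  rw [div_eq_mul_inv, ← Real.exp_neg, Complex.neg_re, Complex.neg_im, mul_neg, neg_neg]
  refine mul_le_mul_of_nonneg_left (Real.exp_le_exp.2 ((le_abs_self _).trans ?_))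
    (Real.rpow_nonneg (norm_nonneg _) _)
  rw [abs_mul]
  exact mul_le_mul_of_nonneg_right (Complex.abs_arg_le_pi x) (abs_nonneg _)

lemma norm_dblExt_le (hF : RealQuadNarrowOne F σ₁ σ₂) (k : ℕ) (s w z₁ z₂ : ℂ)
    (hz₁ : 0 < z₁.im) (hz₂ : 0 < z₂.im) {v : ℝ} (hv : 0 < v) (hwv : w.re - 1 ≤ v)
    (γ δ : SL2O F) :
    ‖dblExt F σ₁ σ₂ k s w z₁ z₂ γ δ‖ ≤
      Real.exp (Real.pi * |s.im|) ^ 2 * (z₁.im * z₂.im) ^ (-v) *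
      ((‖jfac (mat F σ₁ γ) z₁‖ * ‖jfac (mat F σ₂ γ) z₂‖) ^ (-(s.re - v)) *
       (‖jfac (mat F σ₁ δ) z₁‖ * ‖jfac (mat F σ₂ δ) z₂‖) ^ (-(k - s.re - v))) := by
  have hA₁ := norm_pos_iff.2 (jfac_mat_ne_zero σ₁ γ hz₁)
  have hA₂ := norm_pos_iff.2 (jfac_mat_ne_zero σ₂ γ hz₂)
  have hB₁ := norm_pos_iff.2 (jfac_mat_ne_zero σ₁ δ hz₁)
  have hB₂ := norm_pos_iff.2 (jfac_mat_ne_zero σ₂ δ hz₂)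
  have hN : 0 < z₁.im * z₂.im := mul_pos hz₁ hz₂
  unfold dblExt
  split_ifs with hT
  swap
  · rw [norm_zero]; positivity
  obtain ⟨hl₁, hl₂⟩ := hT
  have hle₁ := emb_lowc_mul_im_le σ₁ γ δ z₁
  have hle₂ := emb_lowc_mul_im_le σ₂ γ δ z₂
  have hone : 1 ≤ emb F σ₁ (lowc F γ δ) * emb F σ₂ (lowc F γ δ) := by
    rw [← abs_of_pos (mul_pos (show 0 < emb F σ₁ (lowc F γ δ) from hl₁)
      (show 0 < emb F σ₂ (lowc F γ δ) from hl₂))]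
    refine one_le_abs_emb_mul_emb hF ?_
    intro h
    rw [h, map_zero, map_zero] at hl₁
    exact hl₁.false
  unfold dblSummand
  rw [norm_mul, norm_mul, norm_mul, norm_mul, norm_mul, Complex.norm_cpow_eq_rpow_re_of_pos hl₁,
    Complex.norm_cpow_eq_rpow_re_of_pos hl₂, norm_zpow, norm_zpow]
  have hs₁ := norm_cpow_neg_le (jfac (mat F σ₁ γ) z₁ / jfac (mat F σ₁ δ) z₁) s
  have hs₂ := norm_cpow_neg_le (jfac (mat F σ₂ γ) z₂ / jfac (mat F σ₂ δ) z₂) s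
  rw [norm_div] at hs₁ hs₂
  change emb F σ₁ (lowc F γ δ) ^ _ * emb F σ₂ (lowc F γ δ) ^ _ * _ * _ ≤ _
  change 0 < emb F σ₁ (lowc F γ δ) at hl₁
  change 0 < emb F σ₂ (lowc F γ δ) at hl₂
  rw [← Real.mul_rpow hl₁.le hl₂.le, ← mul_zpow]
  set A₁ := ‖jfac (mat F σ₁ γ) z₁‖
  set A₂ := ‖jfac (mat F σ₂ γ) z₂‖
  set B₁ := ‖jfac (mat F σ₁ δ) z₁‖
  set B₂ := ‖jfac (mat F σ₂ δ) z₂‖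
  set l₁ := emb F σ₁ (lowc F γ δ)
  set l₂ := emb F σ₂ (lowc F γ δ)
  set N := z₁.im * z₂.im with hNdef
  set X := Real.exp (Real.pi * |s.im|)
  have hl : (l₁ * l₂) ^ (w - 1).re ≤ ((A₁ * A₂) * (B₁ * B₂) / N) ^ v := by
    refine (Real.rpow_le_rpow_of_exponent_le hone (by simpa using hwv)).trans
      (Real.rpow_le_rpow (by positivity) ?_ hv.le)
    rw [le_div_iff₀ hN]
    calc l₁ * l₂ * N = (l₁ * z₁.im) * (l₂ * z₂.im) := by rw [hNdef]; ring
      _ ≤ (A₁ * B₁) * (A₂ * B₂) := by gcongr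
      _ = _ := by ring
  have hP : 0 < A₁ * A₂ := by positivity
  have hQ : 0 < B₁ * B₂ := by positivity
  calc (l₁ * l₂) ^ (w - 1).re *
        (‖(jfac (mat F σ₁ γ) z₁ / jfac (mat F σ₁ δ) z₁) ^ (-s)‖ *
          ‖(jfac (mat F σ₂ γ) z₂ / jfac (mat F σ₂ δ) z₂) ^ (-s)‖) * (B₁ * B₂) ^ (-(k : ℤ))
      ≤ ((A₁ * A₂) * (B₁ * B₂) / N) ^ v *
        (((A₁ / B₁) ^ (-s.re) * X) * ((A₂ / B₂) ^ (-s.re) * X)) * (B₁ * B₂) ^ (-(k : ℤ)) := by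
        gcongr
    _ = X ^ 2 * ((A₁ * A₂) * (B₁ * B₂) / N) ^ v *
        ((A₁ * A₂) / (B₁ * B₂)) ^ (-s.re) * (B₁ * B₂) ^ (-(k : ℤ)) := by
        rw [mul_div_mul_comm A₁ A₂ B₁ B₂, Real.mul_rpow (x := A₁ / B₁) (by positivity) (by positivity)]
        ring
    _ = _ := by
        generalize A₁ * A₂ = P at *
        generalize B₁ * B₂ = Q at *
        have hk : Q ^ (-(k : ℤ)) = Q ^ (-(k : ℝ)) := by
          rw [← Real.rpow_intCast]; push_cast; rfl
        rw [hk, Real.div_rpow (by positivity) hN.le, Real.mul_rpow hP.le hQ.le,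
          Real.div_rpow hP.le hQ.le, div_eq_mul_inv, div_eq_mul_inv, ← Real.rpow_neg hN.le,
          ← Real.rpow_neg hQ.le, neg_neg,
          show -(s.re - v) = v + -s.re by ring, show -(k - s.re - v) = v + s.re + -k by ring,
          Real.rpow_add hP, Real.rpow_add hQ, Real.rpow_add hQ]
        ring

lemma rpow_neg_le_of_le_mul {x K P r : ℝ} (hx : 0 < x) (hK : 0 < K) (hP : 0 < P) (hr : 0 ≤ r)
    (h : x ≤ K * P) : P ^ (-r) ≤ K ^ r * x ^ (-r) := by
  have h1 := Real.rpow_le_rpow_of_nonpos hx h (neg_nonpos.2 hr)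
  rw [Real.mul_rpow hK.le hP.le, Real.rpow_neg hK.le] at h1
  rwa [inv_mul_le_iff₀ (by positivity)] at h1

lemma gammaInfRel_of_bottom_row_eq {γ γ' : SL2O F} (h0 : γ 1 0 = γ' 1 0) (h1 : γ 1 1 = γ' 1 1) :
    GammaInfRel F σ₁ σ₂ γ γ' := by
  have hγ := γ.det_coe
  have hγ' := γ'.det_coe
  rw [Matrix.det_fin_two] at hγ hγ'
  refine ⟨γ' * γ⁻¹, ?_, by group⟩
  have h10 : (γ' * γ⁻¹) 1 0 = 0 := by
    change lowc F γ' γ = 0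
    rw [lowc_eq, h0, h1]; ring
  have h11 : (γ' * γ⁻¹) 1 1 = 1 := by
    simp only [Matrix.SpecialLinearGroup.coe_mul, Matrix.SpecialLinearGroup.coe_inv,
      Matrix.adjugate_fin_two, Matrix.mul_apply, Fin.sum_univ_two, ← h0, ← h1]
    simp
    linear_combination hγ
  have h00 : (γ' * γ⁻¹) 0 0 = 1 := by
    simp only [Matrix.SpecialLinearGroup.coe_mul, Matrix.SpecialLinearGroup.coe_inv,
      Matrix.adjugate_fin_two, Matrix.mul_apply, Fin.sum_univ_two, h0, h1]
    simp
    linear_combination hγ'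
  refine ⟨h10, ?_, ?_⟩
  · rw [h00]; simp [TotPos]
  · rw [h11]; simp [TotPos]

end Estimates

section Domination

set_option linter.unusedSectionVars false

variable {F}
variable {σ₁ σ₂ : F →+* ℝ}

/-- The majorant of one Eisenstein factor, indexed by a bottom row. -/
def rowWeight (σ₁ σ₂ : F →+* ℝ) (r : ℝ)
    (x : NumberField.RingOfIntegers F × NumberField.RingOfIntegers F) : ℝ :=
  (1 + house σ₁ σ₂ x.1) ^ (-r) * (1 + house σ₁ σ₂ x.2) ^ (-r)

lemma rowWeight_nonneg (r : ℝ) (x : NumberField.RingOfIntegers F × NumberField.RingOfIntegers F) :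
    0 ≤ rowWeight σ₁ σ₂ r x := by
  have h1 := house_nonneg (σ₁ := σ₁) (σ₂ := σ₂) x.1
  have h2 := house_nonneg (σ₁ := σ₁) (σ₂ := σ₂) x.2
  unfold rowWeight
  positivity

lemma summable_rowWeight (hF : RealQuadNarrowOne F σ₁ σ₂) {r : ℝ} (hr : 2 < r) :
    Summable (rowWeight σ₁ σ₂ r) := by
  have h := summable_one_add_house_rpow hF hr
  have h0 : ∀ a : NumberField.RingOfIntegers F, 0 ≤ (1 + house σ₁ σ₂ a) ^ (-r) := fun a =>
    Real.rpow_nonneg (by linarith [house_nonneg (σ₁ := σ₁) (σ₂ := σ₂) a]) _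
  exact h.mul_of_nonneg h h0 h0

/-- A single uniform bound for the double series in terms of the norm of the imaginary part. -/
lemma exists_norm_tsum_le (hF : RealQuadNarrowOne F σ₁ σ₂) (k : ℕ) (s w : ℂ) {v m : ℝ}
    (hv : 0 < v) (hwv : w.re - 1 ≤ v) (hvs : 2 < s.re - v) (hvk : 2 < k - s.re - v) (hm : 0 < m) :
    ∃ C : ℝ, ∀ z₁ z₂ : ℂ, m ≤ z₁.im → m ≤ z₂.im →
      ∀ g : Quot (PairRel F σ₁ σ₂) → ℂ,
        (∀ p : SL2O F × SL2O F, g (Quot.mk _ p) = dblExt F σ₁ σ₂ k s w z₁ z₂ p.1 p.2) →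
        ‖∑' q, g q‖ ≤ C * (z₁.im * z₂.im) ^ (-v) := by
  obtain ⟨L, hL, hbal⟩ := exists_balanced hF
  obtain ⟨X, hX, hcov⟩ := exists_abs_sub_emb_le hF.2.1
  obtain ⟨K, hK, hbound⟩ := exists_one_add_house_mul_le hF hm hX hL
  set r₁ := s.re - v
  set r₂ := k - s.re - v
  set Φ : (NumberField.RingOfIntegers F × NumberField.RingOfIntegers F) ×
      (NumberField.RingOfIntegers F × NumberField.RingOfIntegers F) → ℝ :=
    fun x => rowWeight σ₁ σ₂ r₁ x.1 * rowWeight σ₁ σ₂ r₂ x.2 with hΦ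
  have hΦ0 : ∀ x, 0 ≤ Φ x := fun x => mul_nonneg (rowWeight_nonneg _ _) (rowWeight_nonneg _ _)
  have hΦs : Summable Φ := (summable_rowWeight hF hvs).mul_of_nonneg (summable_rowWeight hF hvk)
    (rowWeight_nonneg _) (rowWeight_nonneg _)
  refine ⟨Real.exp (Real.pi * |s.im|) ^ 2 * (K ^ r₁ * K ^ r₂) * ∑' x, Φ x,
    fun z₁ z₂ hz₁ hz₂ g hg => ?_⟩
  have hz₁' := hm.trans_le hz₁
  have hz₂' := hm.trans_le hz₂
  obtain ⟨α, hα₁, hα₂⟩ := hcov z₁.re z₂.re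
  have hrep : ∀ q : Quot (PairRel F σ₁ σ₂), ∃ p : SL2O F × SL2O F, Quot.mk _ p = q ∧
      (‖jfac (mat F σ₁ p.1) z₁‖ ≤ L * ‖jfac (mat F σ₂ p.1) z₂‖ ∧
      ‖jfac (mat F σ₂ p.1) z₂‖ ≤ L * ‖jfac (mat F σ₁ p.1) z₁‖) ∧
      ‖jfac (mat F σ₁ p.2) z₁‖ ≤ L * ‖jfac (mat F σ₂ p.2) z₂‖ ∧
      ‖jfac (mat F σ₂ p.2) z₂‖ ≤ L * ‖jfac (mat F σ₁ p.2) z₁‖ := by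
    rintro ⟨γ, δ⟩
    obtain ⟨γ', hγ, hγb⟩ := hbal z₁ z₂ hz₁' hz₂' γ
    obtain ⟨δ', hδ, hδb⟩ := hbal z₁ z₂ hz₁' hz₂' δ
    exact ⟨(γ', δ'), (Quot.sound ⟨hγ, hδ⟩).symm, hγb, hδb⟩
  choose rep hrep_mk hrep₁ hrep₂ using hrep
  let row : SL2O F → NumberField.RingOfIntegers F × NumberField.RingOfIntegers F :=
    fun γ => (γ 1 0, γ 1 1 + γ 1 0 * α)
  have hrow : ∀ {γ γ' : SL2O F}, row γ = row γ' → GammaInfRel F σ₁ σ₂ γ γ' := by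
    intro γ γ' h
    have h0 : γ 1 0 = γ' 1 0 := congrArg Prod.fst h
    have h1 : γ 1 1 + γ 1 0 * α = γ' 1 1 + γ' 1 0 * α := congrArg Prod.snd h
    rw [h0] at h1
    exact gammaInfRel_of_bottom_row_eq h0 (add_right_cancel h1)
  let ι : Quot (PairRel F σ₁ σ₂) → _ := fun q => (row (rep q).1, row (rep q).2)
  have hι : Function.Injective ι := by
    intro q q' h
    rw [← hrep_mk q, ← hrep_mk q']
    exact Quot.sound ⟨hrow (congrArg Prod.fst h), hrow (congrArg Prod.snd h)⟩
  have hweight : ∀ {r : ℝ}, 0 ≤ r → ∀ γ : SL2O F,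
      ‖jfac (mat F σ₁ γ) z₁‖ ≤ L * ‖jfac (mat F σ₂ γ) z₂‖ →
      ‖jfac (mat F σ₂ γ) z₂‖ ≤ L * ‖jfac (mat F σ₁ γ) z₁‖ →
      (‖jfac (mat F σ₁ γ) z₁‖ * ‖jfac (mat F σ₂ γ) z₂‖) ^ (-r) ≤
        K ^ r * rowWeight σ₁ σ₂ r (row γ) := by
    intro r hr γ h1 h2
    have hc := house_nonneg (σ₁ := σ₁) (σ₂ := σ₂) (row γ).1
    have hd := house_nonneg (σ₁ := σ₁) (σ₂ := σ₂) (row γ).2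
    rw [rowWeight, ← Real.mul_rpow (by linarith) (by linarith)]
    exact rpow_neg_le_of_le_mul (by positivity) hK
      (mul_pos (norm_pos_iff.2 (jfac_mat_ne_zero _ _ hz₁'))
        (norm_pos_iff.2 (jfac_mat_ne_zero _ _ hz₂'))) hr
      (hbound _ _ α z₁ z₂ (bottom_row_ne_zero γ) hz₁ hz₂ hα₁ hα₂ h1 h2)
  set D := Real.exp (Real.pi * |s.im|) ^ 2 * (z₁.im * z₂.im) ^ (-v) * (K ^ r₁ * K ^ r₂) with hD
  have hD0 : 0 ≤ D := by positivity
  have hterm : ∀ q, ‖g q‖ ≤ D * Φ (ι q) := by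
    intro q
    conv_lhs => rw [← hrep_mk q, hg]
    refine (norm_dblExt_le hF k s w z₁ z₂ hz₁' hz₂' hv hwv _ _).trans ?_
    have h1 := hweight (r := r₁) (by linarith) _ (hrep₁ q).1 (hrep₁ q).2
    have h2 := hweight (r := r₂) (by linarith) _ (hrep₂ q).1 (hrep₂ q).2
    calc _ ≤ Real.exp (Real.pi * |s.im|) ^ 2 * (z₁.im * z₂.im) ^ (-v) *
          ((K ^ r₁ * rowWeight σ₁ σ₂ r₁ (row (rep q).1)) *
            (K ^ r₂ * rowWeight σ₁ σ₂ r₂ (row (rep q).2))) := by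
          refine mul_le_mul_of_nonneg_left (mul_le_mul h1 h2 (by positivity) ?_) (by positivity)
          exact mul_nonneg (by positivity) (rowWeight_nonneg _ _)
      _ = D * Φ (ι q) := by rw [hD, hΦ]; ring
  have hs := (hΦs.comp_injective hι).mul_left D
  calc ‖∑' q, g q‖ ≤ ∑' q, D * Φ (ι q) := tsum_of_norm_bounded hs.hasSum hterm
    _ = D * ∑' q, Φ (ι q) := tsum_mul_left
    _ ≤ D * ∑' x, Φ x :=
        mul_le_mul_of_nonneg_left (tsum_comp_le_tsum_of_inj hΦs hΦ0 hι) hD0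
    _ = _ := by rw [hD]; ring

end Domination

/-- For even `k ≥ 6`, `2 < Re s < k - 2`,
`Re w < min (Re s - 1) (k - 1 - Re s)` and fixed `Y > 1`, the double Eisenstein series
`E_{s,k-s}(z;w)` tends to `0` as `y₁y₂ → ∞` subject to `Y⁻¹ ≤ y₁/y₂ ≤ Y`. -/
theorem statement13 (σ₁ σ₂ : F →+* ℝ) (hF : RealQuadNarrowOne F σ₁ σ₂)
    (k : ℕ) (hkeven : Even k) (hk6 : 6 ≤ k)
    (s w : ℂ) (hs1 : 2 < s.re) (hs2 : s.re < (k : ℝ) - 2)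
    (hw : w.re < min (s.re - 1) ((k : ℝ) - 1 - s.re))
    (Y : ℝ) (hY : 1 < Y)
    (E : ℂ → ℂ → ℂ)
    (hE : ∀ u₁ u₂ : ℂ, 0 < u₁.im → 0 < u₂.im →
      ∀ g : Quot (PairRel F σ₁ σ₂) → ℂ,
        (∀ p : SL2O F × SL2O F, g (Quot.mk _ p) = dblExt F σ₁ σ₂ k s w u₁ u₂ p.1 p.2) →
        E u₁ u₂ = ∑' q, g q) :
    ∀ ε : ℝ, 0 < ε → ∃ T : ℝ, 0 < T ∧
      ∀ x₁ x₂ y₁ y₂ : ℝ, 0 < y₁ → 0 < y₂ →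
        Y⁻¹ ≤ y₁ / y₂ → y₁ / y₂ ≤ Y → T < y₁ * y₂ →
        ‖E ((x₁ : ℂ) + (y₁ : ℂ) * Complex.I) ((x₂ : ℂ) + (y₂ : ℂ) * Complex.I)‖ < ε := by
  obtain ⟨v, hv1, hv2⟩ := exists_between (show max (w.re - 1) 0 <
      min (s.re - 2) (k - s.re - 2) by
    obtain ⟨h1, h2⟩ := lt_min_iff.1 hw
    exact max_lt (lt_min (by linarith) (by linarith)) (lt_min (by linarith) (by linarith)))
  obtain ⟨hwv, hv0⟩ := max_lt_iff.1 hv1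
  obtain ⟨hvs, hvk⟩ := lt_min_iff.1 hv2
  have hY0 : 0 < Y := zero_lt_one.trans hY
  have hYi : 0 < Y⁻¹ := inv_pos.2 hY0
  have hYi1 : Y⁻¹ ≤ 1 := inv_le_one_of_one_le₀ hY.le
  obtain ⟨C, hC⟩ := exists_norm_tsum_le hF k s w hv0 hwv.le (by linarith) (by linarith) hYi
  intro ε hε
  have hlim : Filter.Tendsto (fun N : ℝ => C * N ^ (-v)) Filter.atTop (nhds 0) := by
    simpa using (tendsto_rpow_neg_atTop hv0).const_mul C
  obtain ⟨T, hT⟩ := Filter.eventually_atTop.1 (hlim.eventually_lt_const hε)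
  refine ⟨max T 1, by positivity, fun x₁ x₂ y₁ y₂ hy₁ hy₂ hlo hhi hTy => ?_⟩
  obtain ⟨hTy', hy1⟩ := max_lt_iff.1 hTy
  have him : ∀ x y : ℝ, ((x : ℂ) + (y : ℂ) * Complex.I).im = y := fun x y => by simp
  rw [le_div_iff₀ hy₂] at hlo
  rw [div_le_iff₀ hy₂, ← inv_mul_le_iff₀ hY0] at hhi
  have hm₁ : Y⁻¹ ≤ y₁ := by
    by_contra! h
    have : y₂ < 1 := by nlinarith
    nlinarith
  have hm₂ : Y⁻¹ ≤ y₂ := by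
    by_contra! h
    have : y₁ < 1 := by nlinarith
    nlinarith
  let g : Quot (PairRel F σ₁ σ₂) → ℂ := Quot.lift
    (fun p => dblExt F σ₁ σ₂ k s w ((x₁ : ℂ) + (y₁ : ℂ) * Complex.I)
      ((x₂ : ℂ) + (y₂ : ℂ) * Complex.I) p.1 p.2) fun _ _ h => dblExt_congr hF _ _ _ _ _ h
  rw [hE _ _ (by rwa [him]) (by rwa [him]) g fun _ => rfl]
  refine (hC _ _ (by rwa [him]) (by rwa [him]) g fun _ => rfl).trans_lt ?_
  rw [him, him]
  exact hT _ hTy'.le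

end HilbertPaper
end
end
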